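/- arXiv:2208.03788 — 2 statements merged into one kernel-verified Lean document; each statement's English description precedes it below -/
import Mathlib

section
/- Let m, n ≥ 3 be natural numbers with m odd and n even. Then M(P_m × P_n) = mn(m+n)/2 − n/2 − 1. -/
/-- The Manhattan distance between two vertices of the grid graph `P_m × P_n`. -/
def gridDist {m n : ℕ} (p q : Fin m × Fin n) : ℕ :=
  Nat.dist p.1 q.1 + Nat.dist p.2 q.2

/-- The length of the walk induced by a labeling (bijection) `σ` of the vertices of
`P_m × P_n` by `{1, …, mn}`: the sum of Manhattan distances between consecutively
labeled vertices. -/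
def walkLen (m n : ℕ) (σ : Fin m × Fin n ≃ Fin (m * n)) : ℕ :=
  ∑ t : Fin (m * n - 1),
    gridDist (σ.symm (t.castLE (by omega))) (σ.symm ⟨t.val + 1, by omega⟩)

/-- `M(P_m × P_n)`: the maximal length of a walk induced by a labeling of `P_m × P_n`. -/
noncomputable def maxWalk (m n : ℕ) : ℕ := sSup (Set.range (walkLen m n))

/-- Twice the Manhattan distance from `p` to the center of the grid `P_(2a+1) × P_n`. -/
def centerDist {m n : ℕ} (a : ℕ) (p : Fin m × Fin n) : ℕ :=
  2 * Nat.dist p.1 a + Nat.dist (2 * p.2 + 1) n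

theorem two_mul_gridDist_le {m n : ℕ} (a : ℕ) (p q : Fin m × Fin n) :
    2 * gridDist p q ≤ centerDist a p + centerDist a q := by
  simp only [gridDist, centerDist, Nat.dist]
  omega

theorem two_mul_gridDist_eq {m b : ℕ} (a : ℕ) (p q : Fin m × Fin (2 * b))
    (h₁ : (p.1 : ℕ) ≤ a ∧ a ≤ q.1 ∨ (q.1 : ℕ) ≤ a ∧ a ≤ p.1)
    (h₂ : (p.2 : ℕ) < b ∧ b ≤ q.2 ∨ (q.2 : ℕ) < b ∧ b ≤ p.2) :
    2 * gridDist p q = centerDist a p + centerDist a q := by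
  simp only [gridDist, centerDist, Nat.dist]
  omega

theorem one_le_centerDist {m b : ℕ} (a : ℕ) (p : Fin m × Fin (2 * b)) :
    1 ≤ centerDist a p := by
  simp only [centerDist, Nat.dist]
  omega

theorem sum_dist_center_odd (a : ℕ) :
    ∑ i ∈ Finset.range (2 * a + 1), Nat.dist i a = a * (a + 1) := by
  induction a with
  | zero => simp [Nat.dist]
  | succ a ih =>
    rw [show 2 * (a + 1) + 1 = (2 * a + 1) + 1 + 1 by ring, Finset.sum_range_succ,
      Finset.sum_range_succ']
    simp only [Nat.dist_succ_succ, ih]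
    have h₀ : Nat.dist 0 (a + 1) = a + 1 := by simp [Nat.dist]
    have h₁ : Nat.dist (2 * a + 1) a = a + 1 := by
      simp only [Nat.dist]
      omega
    rw [h₀, h₁]
    ring

theorem sum_dist_center_even (b : ℕ) :
    ∑ j ∈ Finset.range (2 * b), Nat.dist (2 * j + 1) (2 * b) = 2 * b ^ 2 := by
  induction b with
  | zero => simp
  | succ b ih =>
    rw [show 2 * (b + 1) = 2 * b + 1 + 1 by ring, Finset.sum_range_succ,
      Finset.sum_range_succ']
    have h : ∀ j, Nat.dist (2 * (j + 1) + 1) (2 * b + 1 + 1) = Nat.dist (2 * j + 1) (2 * b) := by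
      intro j
      simp only [Nat.dist]
      omega
    have h₀ : Nat.dist (2 * 0 + 1) (2 * b + 1 + 1) = 2 * b + 1 := by
      simp only [Nat.dist]
      omega
    have h₁ : Nat.dist (2 * (2 * b) + 1) (2 * b) = 2 * b + 1 := by
      simp only [Nat.dist]
      omega
    simp only [h, ih, h₀, h₁]
    ring

theorem sum_centerDist (a b : ℕ) :
    ∑ p : Fin (2 * a + 1) × Fin (2 * b), centerDist a p
      = 4 * b * (a * (a + 1)) + (2 * a + 1) * (2 * b ^ 2) := by
  rw [Fintype.sum_prod_type]
  simp only [centerDist, Finset.sum_add_distrib, Finset.sum_const, Finset.card_univ,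
    Fintype.card_fin, smul_eq_mul, ← Finset.mul_sum]
  rw [Fin.sum_univ_eq_sum_range (fun i => Nat.dist i a),
    Fin.sum_univ_eq_sum_range (fun j => Nat.dist (2 * j + 1) (2 * b)),
    sum_dist_center_odd, sum_dist_center_even]
  ring

theorem sum_consecutive_add (N : ℕ) (hN : 0 < N) (f : Fin N → ℕ) :
    ∑ t : Fin (N - 1), (f (t.castLE (by omega)) + f ⟨t.val + 1, by omega⟩)
      + (f ⟨0, hN⟩ + f ⟨N - 1, by omega⟩) = 2 * ∑ t, f t := by
  obtain ⟨K, rfl⟩ : ∃ K, N = K + 1 := ⟨N - 1, by omega⟩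
  have h₀ := Fin.sum_univ_succ f
  have h₁ := Fin.sum_univ_castSucc f
  rw [Finset.sum_add_distrib]
  change ∑ t : Fin K, f t.castSucc + ∑ t : Fin K, f t.succ + (f 0 + f (Fin.last K)) = _
  omega

/-- The index, within the left half of the grid, of the vertex `(i, j)` in the optimal walk:
first `(a, b - 1)`, then the lower rows, the rest of the middle row, and the upper rows. -/
def leftIndex (a b i j : ℕ) : ℕ :=
  if a < i then 1 + (i - a - 1) * b + j
  else if i < a then a * b + b + i * b + j
  else if j + 1 = b then 0 else 1 + a * b + j

theorem mul_add_lt_mul {r a b j : ℕ} (hr : r < a) (hj : j < b) : r * b + j < a * b := by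
  have := Nat.mul_le_mul_right b (Nat.succ_le_of_lt hr)
  rw [Nat.succ_mul] at this
  omega

theorem mul_add_inj {r s b j k : ℕ} (hj : j < b) (hk : k < b) (h : r * b + j = s * b + k) :
    r = s ∧ j = k := by
  rcases lt_trichotomy r s with hrs | rfl | hrs
  · have := mul_add_lt_mul hrs hj
    omega
  · omega
  · have := mul_add_lt_mul hrs hk
    omega

theorem leftIndex_spec {a b i j : ℕ} (hi : i < 2 * a + 1) (hj : j < b) :
    (a < i ∧ leftIndex a b i j = 1 + (i - a - 1) * b + j ∧ (i - a - 1) * b + j < a * b) ∨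
    (i < a ∧ leftIndex a b i j = a * b + b + i * b + j ∧ i * b + j < a * b) ∨
    (i = a ∧ j + 1 = b ∧ leftIndex a b i j = 0) ∨
    (i = a ∧ j + 1 < b ∧ leftIndex a b i j = 1 + a * b + j) := by
  unfold leftIndex
  rcases lt_trichotomy i a with h | h | h
  · have := mul_add_lt_mul h hj
    rw [if_neg (by omega), if_pos h]
    omega
  · rw [if_neg (by omega), if_neg (by omega)]
    split_ifs <;> omega
  · have := mul_add_lt_mul (show i - a - 1 < a by omega) hj
    rw [if_pos h]
    omega

theorem leftIndex_lt {a b i j : ℕ} (hi : i < 2 * a + 1) (hj : j < b) :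
    leftIndex a b i j < 2 * (a * b) + b := by
  have := leftIndex_spec hi hj
  omega

theorem leftIndex_inj {a b i j i' j' : ℕ} (hi : i < 2 * a + 1) (hj : j < b)
    (hi' : i' < 2 * a + 1) (hj' : j' < b) (h : leftIndex a b i j = leftIndex a b i' j') :
    i = i' ∧ j = j' := by
  have h₁ := leftIndex_spec hi hj
  have h₂ := leftIndex_spec hi' hj'
  have hD := @mul_add_inj (i - a - 1) (i' - a - 1) b j j' hj hj'
  have hU := @mul_add_inj i i' b j j' hj hj'
  rcases h₁ with h₁ | h₁ | h₁ | h₁ <;> rcases h₂ with h₂ | h₂ | h₂ | h₂ <;> omega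

/-- The position of the vertex `(i, j)` of `P_(2a+1) × P_(2b)` in the optimal walk. The walk
alternates between the two halves, and reversing it amounts to reflecting the grid. -/
def walkIndex (a b i j : ℕ) : ℕ :=
  if j < b then 2 * leftIndex a b i j
  else 2 * (2 * (a * b) + b) - 1 - 2 * leftIndex a b i (2 * b - 1 - j)

theorem walkIndex_spec {a b i j : ℕ} (hi : i < 2 * a + 1) (hj : j < 2 * b) :
    (j < b ∧ walkIndex a b i j = 2 * leftIndex a b i j ∧
      leftIndex a b i j < 2 * (a * b) + b) ∨
    (b ≤ j ∧ walkIndex a b i j + 1 + 2 * leftIndex a b i (2 * b - 1 - j)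
      = 2 * (2 * (a * b) + b) ∧ leftIndex a b i (2 * b - 1 - j) < 2 * (a * b) + b) := by
  unfold walkIndex
  split_ifs with h
  · have := leftIndex_lt hi h
    omega
  · have := leftIndex_lt (j := 2 * b - 1 - j) (b := b) hi (by omega)
    omega

theorem walkIndex_inj {a b i j i' j' : ℕ} (hi : i < 2 * a + 1) (hj : j < 2 * b)
    (hi' : i' < 2 * a + 1) (hj' : j' < 2 * b) (h : walkIndex a b i j = walkIndex a b i' j') :
    i = i' ∧ j = j' := by
  rcases walkIndex_spec hi hj with h₁ | h₁ <;> rcases walkIndex_spec hi' hj' with h₂ | h₂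
  · exact leftIndex_inj hi h₁.1 hi' h₂.1 (by omega)
  · omega
  · omega
  · have := @leftIndex_inj a b i (2 * b - 1 - j) i' (2 * b - 1 - j') hi (by omega) hi' (by omega)
      (by omega)
    omega

theorem opposite_of_walkIndex_succ {a b i j i' j' : ℕ} (hb : 2 ≤ b) (hi : i < 2 * a + 1)
    (hj : j < 2 * b) (hi' : i' < 2 * a + 1) (hj' : j' < 2 * b)
    (h : walkIndex a b i j + 1 = walkIndex a b i' j') :
    (i ≤ a ∧ a ≤ i' ∨ i' ≤ a ∧ a ≤ i) ∧ (j < b ∧ b ≤ j' ∨ j' < b ∧ b ≤ j) := by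
  rcases walkIndex_spec hi hj with h₁ | h₁ <;> rcases walkIndex_spec hi' hj' with h₂ | h₂
  · omega
  · have h₃ := leftIndex_spec hi h₁.1
    have h₄ := leftIndex_spec (j := 2 * b - 1 - j') (b := b) hi' (by omega)
    omega
  · have h₃ := leftIndex_spec hi' h₂.1
    have h₄ := leftIndex_spec (j := 2 * b - 1 - j) (b := b) hi (by omega)
    omega
  · omega

theorem exists_equiv_walkIndex (a b : ℕ) :
    ∃ σ : Fin (2 * a + 1) × Fin (2 * b) ≃ Fin ((2 * a + 1) * (2 * b)),
      ∀ p, (σ p : ℕ) = walkIndex a b p.1 p.2 := by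
  have hN : (2 * a + 1) * (2 * b) = 2 * (2 * (a * b) + b) := by ring
  let f : Fin (2 * a + 1) × Fin (2 * b) → Fin ((2 * a + 1) * (2 * b)) := fun p =>
    ⟨walkIndex a b p.1 p.2, by
      have := walkIndex_spec p.1.isLt p.2.isLt
      omega⟩
  have hf : Function.Bijective f := by
    rw [Fintype.bijective_iff_injective_and_card]
    refine ⟨fun p q h => ?_, by simp⟩
    obtain ⟨h₁, h₂⟩ := walkIndex_inj p.1.isLt p.2.isLt q.1.isLt q.2.isLt (Fin.ext_iff.mp h)
    exact Prod.ext (Fin.ext h₁) (Fin.ext h₂)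
  exact ⟨Equiv.ofBijective f hf, fun _ => rfl⟩

theorem sum_centerDist_consecutive (a b : ℕ) (hN : 0 < (2 * a + 1) * (2 * b))
    (σ : Fin (2 * a + 1) × Fin (2 * b) ≃ Fin ((2 * a + 1) * (2 * b))) :
    ∑ t : Fin ((2 * a + 1) * (2 * b) - 1), (centerDist a (σ.symm (t.castLE (by omega)))
        + centerDist a (σ.symm ⟨t.val + 1, by omega⟩))
      + (centerDist a (σ.symm ⟨0, hN⟩)
        + centerDist a (σ.symm ⟨(2 * a + 1) * (2 * b) - 1, by omega⟩))
      = 2 * (4 * b * (a * (a + 1)) + (2 * a + 1) * (2 * b ^ 2)) := by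
  rw [sum_consecutive_add _ hN fun t => centerDist a (σ.symm t), Equiv.sum_comp σ.symm,
    sum_centerDist]

theorem walkLen_add_one_le (a b : ℕ) (hb : 0 < b)
    (σ : Fin (2 * a + 1) × Fin (2 * b) ≃ Fin ((2 * a + 1) * (2 * b))) :
    walkLen (2 * a + 1) (2 * b) σ + 1
      ≤ 4 * b * (a * (a + 1)) + (2 * a + 1) * (2 * b ^ 2) := by
  have hN : 0 < (2 * a + 1) * (2 * b) := by positivity
  have h := sum_centerDist_consecutive a b hN σ
  have h₀ := one_le_centerDist a (σ.symm ⟨0, hN⟩)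
  have h₁ := one_le_centerDist a (σ.symm ⟨(2 * a + 1) * (2 * b) - 1, by omega⟩)
  have h₂ : 2 * walkLen (2 * a + 1) (2 * b) σ ≤ ∑ t : Fin ((2 * a + 1) * (2 * b) - 1),
      (centerDist a (σ.symm (t.castLE (by omega)))
        + centerDist a (σ.symm ⟨t.val + 1, by omega⟩)) := by
    unfold walkLen
    rw [Finset.mul_sum]
    exact Finset.sum_le_sum fun t _ => two_mul_gridDist_le a _ _
  omega

theorem exists_walkLen_add_one_eq (a b : ℕ) (hb : 2 ≤ b) :
    ∃ σ, walkLen (2 * a + 1) (2 * b) σ + 1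
      = 4 * b * (a * (a + 1)) + (2 * a + 1) * (2 * b ^ 2) := by
  obtain ⟨σ, hσ⟩ := exists_equiv_walkIndex a b
  refine ⟨σ, ?_⟩
  have hN : 0 < (2 * a + 1) * (2 * b) := by positivity
  have hN' : (2 * a + 1) * (2 * b) = 2 * (2 * (a * b) + b) := by ring
  have h := sum_centerDist_consecutive a b hN σ
  have h₀ : centerDist a (σ.symm ⟨0, hN⟩) = 1 := by
    have : σ.symm ⟨0, hN⟩ = (⟨a, by omega⟩, ⟨b - 1, by omega⟩) := by
      rw [Equiv.symm_apply_eq, Fin.ext_iff, hσ]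
      simp [walkIndex, leftIndex, show b - 1 + 1 = b by omega, show 0 < b by omega]
    rw [this]
    simp only [centerDist, Nat.dist]
    omega
  have h₁ : centerDist a (σ.symm ⟨(2 * a + 1) * (2 * b) - 1, by omega⟩) = 1 := by
    have : σ.symm ⟨(2 * a + 1) * (2 * b) - 1, by omega⟩ = (⟨a, by omega⟩, ⟨b, by omega⟩) := by
      rw [Equiv.symm_apply_eq, Fin.ext_iff, hσ]
      simp [walkIndex, leftIndex, show 2 * b - 1 - b + 1 = b by omega, hN']
    rw [this]
    simp only [centerDist, Nat.dist]
    omega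
  have h₂ : 2 * walkLen (2 * a + 1) (2 * b) σ = ∑ t : Fin ((2 * a + 1) * (2 * b) - 1),
      (centerDist a (σ.symm (t.castLE (by omega)))
        + centerDist a (σ.symm ⟨t.val + 1, by omega⟩)) := by
    unfold walkLen
    rw [Finset.mul_sum]
    refine Finset.sum_congr rfl fun t _ => ?_
    have ht := opposite_of_walkIndex_succ hb (σ.symm (t.castLE (by omega))).1.isLt
      (σ.symm (t.castLE (by omega))).2.isLt (σ.symm ⟨t.val + 1, by omega⟩).1.isLt
      (σ.symm ⟨t.val + 1, by omega⟩).2.isLt (by rw [← hσ, ← hσ]; simp)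
    exact two_mul_gridDist_eq a _ _ ht.1 ht.2
  omega

theorem maxWalk_odd_even (m n : ℕ) (hm : 3 ≤ m) (hn : 3 ≤ n)
    (hmo : Odd m) (hne : Even n) :
    maxWalk m n = m * n * (m + n) / 2 - n / 2 - 1 := by
  obtain ⟨a, rfl⟩ := hmo
  obtain ⟨b, rfl⟩ := hne.exists_two_nsmul
  rw [smul_eq_mul] at *
  have hval : (2 * a + 1) * (2 * b) * (2 * a + 1 + 2 * b)
      = 2 * (4 * b * (a * (a + 1)) + (2 * a + 1) * (2 * b ^ 2) + b) := by ring
  obtain ⟨σ, hσ⟩ := exists_walkLen_add_one_eq a b (by omega)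
  have hmax : IsGreatest (Set.range (walkLen (2 * a + 1) (2 * b)))
      (walkLen (2 * a + 1) (2 * b) σ) := by
    refine ⟨⟨σ, rfl⟩, ?_⟩
    rintro _ ⟨τ, rfl⟩
    have := walkLen_add_one_le a b (by omega) τ
    omega
  rw [maxWalk, hmax.csSup_eq, hval]
  omega
end

section
/- Let m, n ≥ 2 be natural numbers. Then M(P_m × P_n) ≤ 2n⌊m/2⌋⌈m/2⌉ − 1_{m even} + 2m⌊n/2⌋⌈n/2⌉ − 1_{n even}, where 1_{k even} equals 1 if k is even and 0 otherwise. -/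
/-- Twice the total distance of `0, …, m - 1` to their midpoint. -/
theorem sum_dist_midpoint (m : ℕ) :
    ∑ i ∈ Finset.range m, Nat.dist (2 * i + 1) m = 2 * (m / 2) * ((m + 1) / 2) := by
  induction m using Nat.twoStepInduction with
  | zero => simp
  | one => simp [Nat.dist]
  | more m ih _ =>
    have hshift : ∀ i, Nat.dist (2 * (i + 1) + 1) (m + 2) = Nat.dist (2 * i + 1) m := by
      intro i
      simp only [Nat.dist]
      omega
    have hlast : Nat.dist (2 * m + 1) m = m + 1 := by
      simp only [Nat.dist]
      omega
    have hfirst : Nat.dist (2 * 0 + 1) (m + 2) = m + 1 := by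
      simp only [Nat.dist]
      omega
    rw [Finset.sum_range_succ', Finset.sum_congr rfl fun i _ => hshift i,
      Finset.sum_range_succ, ih, hlast, hfirst]
    have h₁ : (m + 2) / 2 = m / 2 + 1 := by omega
    have h₂ : (m + 2 + 1) / 2 = (m + 1) / 2 + 1 := by omega
    have h₃ : m = m / 2 + (m + 1) / 2 := by omega
    rw [h₁, h₂]
    generalize m / 2 = a at *
    generalize (m + 1) / 2 = b at *
    subst h₃
    ring

theorem sum_consecutive_add_ends {N : ℕ} (hN : 0 < N) (g : Fin N → ℕ) :
    ∑ t : Fin (N - 1), (g (t.castLE (by omega)) + g ⟨t.val + 1, by omega⟩) +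
      (g ⟨0, hN⟩ + g ⟨N - 1, by omega⟩) = 2 * ∑ t, g t := by
  obtain _ | L := N
  · omega
  · rw [Finset.sum_add_distrib, two_mul]
    nth_rewrite 1 [Fin.sum_univ_castSucc]
    rw [Fin.sum_univ_succ]
    change ∑ t : Fin L, g t.castSucc + ∑ t : Fin L, g t.succ + (g 0 + g (Fin.last L)) = _
    ring

/-- A sequence taking each value below `m` exactly `n` times has bounded total variation. -/
theorem sum_dist_consecutive_le {N m n : ℕ} (hN : 0 < N) (x : Fin N → ℕ)
    (hx : ∑ t, Nat.dist (2 * x t + 1) m =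
      n * ∑ i ∈ Finset.range m, Nat.dist (2 * i + 1) m) :
    ∑ t : Fin (N - 1), Nat.dist (x (t.castLE (by omega))) (x ⟨t.val + 1, by omega⟩) ≤
      2 * n * (m / 2) * ((m + 1) / 2) - (if Even m then 1 else 0) := by
  have htri : 2 * ∑ t : Fin (N - 1),
      Nat.dist (x (t.castLE (by omega))) (x ⟨t.val + 1, by omega⟩) ≤
      ∑ t : Fin (N - 1), (Nat.dist (2 * x (t.castLE (by omega)) + 1) m +
        Nat.dist (2 * x ⟨t.val + 1, by omega⟩ + 1) m) := by
    rw [Finset.mul_sum]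
    refine Finset.sum_le_sum fun t _ => ?_
    simp only [Nat.dist]
    omega
  have hsum := sum_consecutive_add_ends hN fun t => Nat.dist (2 * x t + 1) m
  rw [hx, sum_dist_midpoint] at hsum
  have hends : (if Even m then 2 else 0) ≤ Nat.dist (2 * x ⟨0, hN⟩ + 1) m +
      Nat.dist (2 * x ⟨N - 1, by omega⟩ + 1) m := by
    split_ifs with h
    · obtain ⟨k, rfl⟩ := h
      simp only [Nat.dist]
      omega
    · exact Nat.zero_le _
  have hring : 2 * (n * (2 * (m / 2) * ((m + 1) / 2))) =
      2 * (2 * n * (m / 2) * ((m + 1) / 2)) := by ring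
  rw [hring] at hsum
  split_ifs at hends ⊢ <;> omega

theorem maxWalk_le (m n : ℕ) (hm : 2 ≤ m) (hn : 2 ≤ n) :
    maxWalk m n ≤
      (2 * n * (m / 2) * ((m + 1) / 2) - (if Even m then 1 else 0)) +
      (2 * m * (n / 2) * ((n + 1) / 2) - (if Even n then 1 else 0)) := by
  refine csSup_le' ?_
  rintro _ ⟨σ, rfl⟩
  have hN : 0 < m * n := by positivity
  simp only [walkLen, gridDist, Finset.sum_add_distrib]
  refine Nat.add_le_add
    (sum_dist_consecutive_le hN (fun t => ((σ.symm t).1 : ℕ)) ?_)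
    (sum_dist_consecutive_le hN (fun t => ((σ.symm t).2 : ℕ)) ?_)
  · rw [Equiv.sum_comp σ.symm fun p => Nat.dist (2 * (p.1 : ℕ) + 1) m,
      Fintype.sum_prod_type, Finset.sum_range]
    simp [Finset.mul_sum]
  · rw [Equiv.sum_comp σ.symm fun p => Nat.dist (2 * (p.2 : ℕ) + 1) n,
      Fintype.sum_prod_type, Finset.sum_range]
    simp
end
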